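/- (Lemma 4, inequality (13b).) Assume 0 ≤ p01 ≤ p11 ≤ 1 and β ∈ (0,1]. For every 1 ≤ n ≤ T, every v ∈ [0,1]^N, and every pair of indices j ≤ i with v_j ≥ v_i, the pseudo value function of the batteryless model satisfies W_n(v) ≥ W_n(v ∘ (i j)), where v ∘ (i j) is v with coordinates i and j transposed. -/

import Mathlib

/-- The set of scheduled indices `{1,…,K}` (the first `K` coordinates). -/
def sched (N K : ℕ) : Finset (Fin N) := Finset.univ.filter (fun i => i.val < K)

/-- Sort the entries of a vector in decreasing order. -/
noncomputable def sortVec (N : ℕ) (v : Fin N → ℝ) : Fin N → ℝ :=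
  fun i => ((List.ofFn v).mergeSort (fun a b => decide (b ≤ a))).getD i.val 0

/-- The next belief vector `[P11(Σl), τ(v_Ē), P01(|E|-Σl)]` of the batteryless model:
`|H|` entries `p11` (the active coordinates `H ⊆ E` found harvesting), then
`τ(x) = (p11 - p01)·x + p01` applied entrywise to the coordinates of `v` outside the active
set `E` (kept in their original order), then `|E| - |H|` entries `p01`. -/
noncomputable def nextVec2 (N : ℕ) (p01 p11 : ℝ) (E H : Finset (Fin N)) (v : Fin N → ℝ) :
    Fin N → ℝ :=
  fun i => (List.replicate H.card p11 ++
      ((Finset.univ \ E).sort (· ≤ ·)).map (fun j => (p11 - p01) * v j + p01) ++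
      List.replicate (E.card - H.card) p01).getD i.val 0

/-- The pseudo value function of the batteryless model, indexed by remaining time:
`W2 … m v` is the pseudo value function `W_n(v)` of the paper with `m = T - n` slots
remaining after the current one; `W2 … 0 v = p·Σ_{i=1}^K v_i` and
`W2 … (m+1) v = p·Σ_{i=1}^K v_i + β·Σ_{E ⊆ {1,…,K}} Σ_{H ⊆ E}
  (1-p)^(K-|E|) p^|E| (Π_{j∈H} v_j)(Π_{j∈E∖H}(1-v_j)) · W2 … m ([P11(|H|), τ(v_Ē), P01(|E|-|H|)])`. -/
noncomputable def W2 (N K : ℕ) (β p p01 p11 : ℝ) : ℕ → (Fin N → ℝ) → ℝ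
  | 0, v => p * ∑ i ∈ sched N K, v i
  | m + 1, v => p * ∑ i ∈ sched N K, v i +
      β * ∑ E ∈ (sched N K).powerset, ∑ H ∈ E.powerset,
        ((1 - p) ^ (K - E.card) * p ^ E.card * (∏ j ∈ H, v j) * (∏ j ∈ E \ H, (1 - v j))) *
          W2 N K β p p01 p11 m (nextVec2 N p01 p11 E H v)

section ListModel

/-- The expected value of `f` at the next belief list, when the coordinates in the first list are
scheduled and processed from left to right. The arguments `h`, `u`, `c` record what has been
produced so far: `h` active harvesting coordinates, the updated inactive coordinates `u`, and
`c` active non-harvesting coordinates; the last list holds the unscheduled coordinates. -/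
noncomputable def activationMean (p p01 p11 : ℝ) (f : List ℝ → ℝ) :
    List ℝ → ℕ → List ℝ → ℕ → List ℝ → ℝ
  | [], h, u, c, r => f (List.replicate h p11 ++
      (u ++ (r.map (fun x => (p11 - p01) * x + p01) ++ List.replicate c p01)))
  | x :: L, h, u, c, r =>
      (1 - p) * activationMean p p01 p11 f L h (u ++ [(p11 - p01) * x + p01]) c r +
        p * (x * activationMean p p01 p11 f L (h + 1) u c r +
          (1 - x) * activationMean p p01 p11 f L h u (c + 1) r)

/-- One step of the dynamic programming recursion, on lists. -/
noncomputable def bellmanStep (K : ℕ) (β p p01 p11 : ℝ) (f : List ℝ → ℝ) (l : List ℝ) : ℝ :=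
  p * (l.take K).sum + β * activationMean p p01 p11 f (l.take K) 0 [] 0 (l.drop K)

/-- The properties of a value function on lists of length `N` that are propagated by
`bellmanStep`. -/
structure IsRegularValue (N K : ℕ) (f : List ℝ → ℝ) : Prop where
  perm : ∀ l l' r : List ℝ, l.Perm l' → l.length ≤ K → l.length + r.length = N →
    f (l ++ r) = f (l' ++ r)
  affine : ∀ (l r : List ℝ) (a b t : ℝ),
    f (l ++ (t * a + (1 - t) * b) :: r) = t * f (l ++ a :: r) + (1 - t) * f (l ++ b :: r)
  swap : ∀ (X R : List ℝ) (x y : ℝ), X.length + R.length + 2 = N →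
    (∀ z ∈ X ++ x :: y :: R, z ∈ Set.Icc (0 : ℝ) 1) → y ≤ x →
    f (X ++ y :: x :: R) ≤ f (X ++ x :: y :: R)
  rotate : ∀ (L : List ℝ) (y : ℝ), L.length + 1 = N →
    (∀ z ∈ y :: L, z ∈ Set.Icc (0 : ℝ) 1) → f (L ++ [y]) ≤ f (y :: L) + 1

variable {N K : ℕ} {β p p01 p11 : ℝ} {f : List ℝ → ℝ}

namespace IsRegularValue

lemma move_large (hf : IsRegularValue N K f) (M X R : List ℝ) (x : ℝ)
    (hN : X.length + M.length + R.length + 1 = N)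
    (hb : ∀ z ∈ X ++ x :: (M ++ R), z ∈ Set.Icc (0 : ℝ) 1) (hM : ∀ z ∈ M, z ≤ x) :
    f (X ++ (M ++ x :: R)) ≤ f (X ++ x :: (M ++ R)) := by
  induction M generalizing X with
  | nil => simp
  | cons z M ih =>
    have h1 := ih (X ++ [z]) (by simp at hN ⊢; omega) (by
      intro w hw; apply hb; simp at hw ⊢; tauto) (fun w hw => hM w (by simp [hw]))
    have h2 := hf.swap X (M ++ R) x z (by simp at hN ⊢; omega) (by simpa using hb)
      (hM z (by simp))
    simp only [List.append_assoc, List.cons_append, List.nil_append] at h1 h2 ⊢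
    exact h1.trans h2

lemma move_small (hf : IsRegularValue N K f) (M X R : List ℝ) (y : ℝ)
    (hN : X.length + M.length + R.length + 1 = N)
    (hb : ∀ z ∈ X ++ y :: (M ++ R), z ∈ Set.Icc (0 : ℝ) 1) (hM : ∀ z ∈ M, y ≤ z) :
    f (X ++ y :: (M ++ R)) ≤ f (X ++ (M ++ y :: R)) := by
  induction M generalizing X with
  | nil => simp
  | cons z M ih =>
    have h1 := ih (X ++ [z]) (by simp at hN ⊢; omega) (by
      intro w hw; apply hb; simp at hw ⊢; tauto) (fun w hw => hM w (by simp [hw]))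
    have h2 := hf.swap X (M ++ R) z y (by simp at hN ⊢; omega) (by
      intro w hw; apply hb; simp at hw ⊢; tauto) (hM z (by simp))
    simp only [List.append_assoc, List.cons_append, List.nil_append] at h1 h2 ⊢
    exact h2.trans h1

/-- The multilinear expansion of an affine value function in two of its entries. -/
lemma biaffine_eq
    (haff : ∀ (l r : List ℝ) (a b t : ℝ),
      f (l ++ (t * a + (1 - t) * b) :: r) = t * f (l ++ a :: r) + (1 - t) * f (l ++ b :: r))
    (X M R : List ℝ) (a b : ℝ) :
    f (X ++ a :: (M ++ b :: R)) =
      a * (b * f (X ++ 1 :: (M ++ 1 :: R)) + (1 - b) * f (X ++ 1 :: (M ++ 0 :: R))) +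
      (1 - a) * (b * f (X ++ 0 :: (M ++ 1 :: R)) + (1 - b) * f (X ++ 0 :: (M ++ 0 :: R))) := by
  have e1 := haff X (M ++ b :: R) 1 0 a
  have e2 := haff (X ++ 1 :: M) R 1 0 b
  have e3 := haff (X ++ 0 :: M) R 1 0 b
  simp only [mul_one, mul_zero, add_zero, List.append_assoc, List.cons_append] at e1 e2 e3
  rw [e1, e2, e3]

/-- The difference of an affine value function under exchanging two entries. -/
lemma exchange_eq
    (haff : ∀ (l r : List ℝ) (a b t : ℝ),
      f (l ++ (t * a + (1 - t) * b) :: r) = t * f (l ++ a :: r) + (1 - t) * f (l ++ b :: r))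
    (X M R : List ℝ) (x y : ℝ) :
    f (X ++ x :: (M ++ y :: R)) - f (X ++ y :: (M ++ x :: R)) =
      (x - y) * (f (X ++ 1 :: (M ++ 0 :: R)) - f (X ++ 0 :: (M ++ 1 :: R))) := by
  rw [biaffine_eq haff X M R x y, biaffine_eq haff X M R y x]
  ring

lemma exchange (hf : IsRegularValue N K f) (X M R : List ℝ) (x y : ℝ)
    (hN : X.length + M.length + R.length + 2 = N)
    (hb : ∀ z ∈ X ++ (M ++ R), z ∈ Set.Icc (0 : ℝ) 1) (hxy : y ≤ x) :
    f (X ++ y :: (M ++ x :: R)) ≤ f (X ++ x :: (M ++ y :: R)) := by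
  have h := exchange_eq hf.affine X M R x y
  have hM : ∀ z ∈ M, z ∈ Set.Icc (0 : ℝ) 1 := fun z hz => hb z (by simp [hz])
  have hb' : ∀ z, z = 0 ∨ z = 1 ∨ z ∈ X ∨ z ∈ M ∨ z ∈ R → z ∈ Set.Icc (0 : ℝ) 1 := by
    rintro z (rfl | rfl | hz)
    · simp
    · simp
    · exact hb z (by simpa using hz)
  have h1 := hf.move_small M X (1 :: R) 0 (by simp; omega)
    (fun z hz => hb' z (by simp at hz; tauto)) (fun z hz => (hM z hz).1)
  have h2 := hf.swap (X ++ M) R 1 0 (by simp; omega)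
    (fun z hz => hb' z (by simp at hz; tauto)) zero_le_one
  have h3 := hf.move_large M X (0 :: R) 1 (by simp; omega)
    (fun z hz => hb' z (by simp at hz; tauto)) (fun z hz => (hM z hz).2)
  simp only [List.append_assoc] at h2
  have := mul_nonneg (sub_nonneg.2 hxy) (sub_nonneg.2 (h1.trans (h2.trans h3)))
  linarith

/-- Moving a smallest entry from the end to any earlier place costs at most `1`. -/
lemma move_last (hf : IsRegularValue N K f) (X S : List ℝ) (y : ℝ)
    (hN : X.length + S.length + 1 = N) (hy : 0 ≤ y)
    (hb : ∀ z ∈ y :: (X ++ S), z ∈ Set.Icc y 1) :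
    f (X ++ (S ++ [y])) ≤ f (X ++ y :: S) + 1 := by
  have hb' : ∀ z ∈ y :: (X ++ S), z ∈ Set.Icc (0 : ℝ) 1 :=
    fun z hz => ⟨hy.trans (hb z hz).1, (hb z hz).2⟩
  have h1 := hf.rotate (X ++ S) y (by simp; omega) hb'
  have h2 := hf.move_small X [] S y (by simp; omega) (by simpa using hb')
    (fun z hz => (hb z (by simp [hz])).1)
  simp only [List.append_assoc, List.nil_append] at h1 h2
  linarith

end IsRegularValue

lemma activationMean_perm_inactive (hf : IsRegularValue N K f) (L : List ℝ) (h : ℕ)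
    (u u' : List ℝ) (c : ℕ) (r : List ℝ) (hu : u.Perm u') (hK : h + u.length + L.length ≤ K)
    (hN : h + u.length + L.length + c + r.length = N) :
    activationMean p p01 p11 f L h u c r = activationMean p p01 p11 f L h u' c r := by
  induction L generalizing h u u' c with
  | nil =>
    have := hf.perm (List.replicate h p11 ++ u) (List.replicate h p11 ++ u')
      (r.map (fun x => (p11 - p01) * x + p01) ++ List.replicate c p01) (hu.append_left _)
      (by simpa using hK) (by simp at hN ⊢; omega)
    simpa [activationMean] using this
  | cons x L ih =>
    simp only [activationMean]
    rw [ih h _ (u' ++ [(p11 - p01) * x + p01]) c (hu.append_right _)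
        (by simp at hK ⊢; omega) (by simp at hN ⊢; omega),
      ih (h + 1) u u' c hu (by simp at hK ⊢; omega) (by simp at hN ⊢; omega),
      ih h u u' (c + 1) hu (by simp at hK ⊢; omega) (by simp at hN ⊢; omega)]

lemma activationMean_perm (hf : IsRegularValue N K f) (L L' : List ℝ) (hL : L.Perm L') (h : ℕ)
    (u : List ℝ) (c : ℕ) (r : List ℝ) (hK : h + u.length + L.length ≤ K)
    (hN : h + u.length + L.length + c + r.length = N) :
    activationMean p p01 p11 f L h u c r = activationMean p p01 p11 f L' h u c r := by
  induction hL generalizing h u c with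
  | nil => rfl
  | cons x _ ih =>
    simp only [activationMean]
    rw [ih h _ c (by simp at hK ⊢; omega) (by simp at hN ⊢; omega),
      ih (h + 1) u c (by simp at hK ⊢; omega) (by simp at hN ⊢; omega),
      ih h u (c + 1) (by simp at hK ⊢; omega) (by simp at hN ⊢; omega)]
  | swap x y L =>
    simp only [activationMean]
    rw [activationMean_perm_inactive hf L h
      (u ++ [(p11 - p01) * y + p01] ++ [(p11 - p01) * x + p01])
      (u ++ [(p11 - p01) * x + p01] ++ [(p11 - p01) * y + p01]) c r
      (by simpa using List.Perm.append_left u (List.Perm.swap _ _ []))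
      (by simp at hK ⊢; omega) (by simp at hN ⊢; omega)]
    ring
  | trans h1 _ ih1 ih2 =>
    rw [ih1 h u c hK hN, ih2 h u c (by rw [← h1.length_eq]; exact hK)
      (by rw [← h1.length_eq]; exact hN)]

lemma activationMean_affine_inactive (hf : IsRegularValue N K f) (L : List ℝ) (h : ℕ)
    (u u' : List ℝ) (c : ℕ) (r : List ℝ) (a b t : ℝ) :
    activationMean p p01 p11 f L h (u ++ (t * a + (1 - t) * b) :: u') c r =
      t * activationMean p p01 p11 f L h (u ++ a :: u') c r +
        (1 - t) * activationMean p p01 p11 f L h (u ++ b :: u') c r := by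
  induction L generalizing h u' c with
  | nil =>
    have := hf.affine (List.replicate h p11 ++ u)
      (u' ++ (r.map (fun x => (p11 - p01) * x + p01) ++ List.replicate c p01)) a b t
    simpa [activationMean] using this
  | cons x L ih =>
    simp only [activationMean, List.append_assoc, List.cons_append]
    rw [ih, ih, ih]
    ring

lemma activationMean_affine_rest (hf : IsRegularValue N K f) (L : List ℝ) (h : ℕ)
    (u : List ℝ) (c : ℕ) (r r' : List ℝ) (a b t : ℝ) :
    activationMean p p01 p11 f L h u c (r ++ (t * a + (1 - t) * b) :: r') =
      t * activationMean p p01 p11 f L h u c (r ++ a :: r') +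
        (1 - t) * activationMean p p01 p11 f L h u c (r ++ b :: r') := by
  induction L generalizing h u c with
  | nil =>
    have := hf.affine
      (List.replicate h p11 ++ (u ++ r.map (fun x => (p11 - p01) * x + p01)))
      (r'.map (fun x => (p11 - p01) * x + p01) ++ List.replicate c p01)
      ((p11 - p01) * a + p01) ((p11 - p01) * b + p01) t
    rw [show t * ((p11 - p01) * a + p01) + (1 - t) * ((p11 - p01) * b + p01) =
      (p11 - p01) * (t * a + (1 - t) * b) + p01 by ring] at this
    simpa [activationMean] using this
  | cons x L ih =>
    simp only [activationMean]
    rw [ih, ih, ih]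
    ring

lemma activationMean_affine_scheduled (hf : IsRegularValue N K f) (L L' : List ℝ) (h : ℕ)
    (u : List ℝ) (c : ℕ) (r : List ℝ) (a b t : ℝ) :
    activationMean p p01 p11 f (L ++ (t * a + (1 - t) * b) :: L') h u c r =
      t * activationMean p p01 p11 f (L ++ a :: L') h u c r +
        (1 - t) * activationMean p p01 p11 f (L ++ b :: L') h u c r := by
  induction L generalizing h u c with
  | nil =>
    simp only [activationMean, List.nil_append]
    rw [show (p11 - p01) * (t * a + (1 - t) * b) + p01 =
      t * ((p11 - p01) * a + p01) + (1 - t) * ((p11 - p01) * b + p01) by ring,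
      activationMean_affine_inactive hf]
    ring
  | cons x L ih =>
    simp only [activationMean, List.cons_append]
    rw [ih, ih, ih]
    ring

lemma activationMean_le_add (hp : p ∈ Set.Icc (0 : ℝ) 1) (hp0111 : p01 ≤ p11) (d : ℝ)
    (L : List ℝ) (hL : ∀ z ∈ L, z ∈ Set.Icc (0 : ℝ) 1)
    (h h' : ℕ) (u u' : List ℝ) (c c' : ℕ) (r r' : List ℝ)
    (hcmp : ∀ (k e : ℕ) (w : List ℝ), k + w.length + e = L.length →
      (∀ z ∈ w, z ∈ Set.Icc p01 p11) →
      f (List.replicate (h + k) p11 ++ ((u ++ w) ++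
        (r.map (fun x => (p11 - p01) * x + p01) ++ List.replicate (c + e) p01))) ≤
      f (List.replicate (h' + k) p11 ++ ((u' ++ w) ++
        (r'.map (fun x => (p11 - p01) * x + p01) ++ List.replicate (c' + e) p01))) + d) :
    activationMean p p01 p11 f L h u c r ≤ activationMean p p01 p11 f L h' u' c' r' + d := by
  induction L generalizing h h' u u' c c' with
  | nil => simpa [activationMean] using hcmp 0 0 [] (by simp) (by simp)
  | cons x L ih =>
    obtain ⟨hx, hL⟩ := List.forall_mem_cons.1 hL
    have h1 := ih hL h h' (u ++ [(p11 - p01) * x + p01]) (u' ++ [(p11 - p01) * x + p01]) c c' (by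
      intro k e w hw hwb
      have := hcmp k e (((p11 - p01) * x + p01) :: w) (by simp; omega) (by
        intro z hz
        rcases List.mem_cons.1 hz with rfl | hz
        · constructor <;> nlinarith [hx.1, hx.2]
        · exact hwb z hz)
      simpa using this)
    have h2 := ih hL (h + 1) (h' + 1) u u' c c' (by
      intro k e w hw hwb
      have := hcmp (k + 1) e w (by simp; omega) hwb
      rwa [show h + (k + 1) = h + 1 + k by omega, show h' + (k + 1) = h' + 1 + k by omega] at this)
    have h3 := ih hL h h' u u' (c + 1) (c' + 1) (by
      intro k e w hw hwb
      have := hcmp k (e + 1) w (by simp; omega) hwb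
      rwa [show c + (e + 1) = c + 1 + e by omega, show c' + (e + 1) = c' + 1 + e by omega] at this)
    simp only [activationMean]
    have g1 := mul_le_mul_of_nonneg_left h1 (sub_nonneg.2 hp.2)
    have g2 := mul_le_mul_of_nonneg_left h2 (mul_nonneg hp.1 hx.1)
    have g3 := mul_le_mul_of_nonneg_left h3 (mul_nonneg hp.1 (sub_nonneg.2 hx.2))
    linarith

lemma bellmanStep_append (L r : List ℝ) (hL : L.length = K) :
    bellmanStep K β p p01 p11 f (L ++ r) =
      p * L.sum + β * activationMean p p01 p11 f L 0 [] 0 r := by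
  simp [bellmanStep, ← hL]

lemma bellmanStep_perm (hf : IsRegularValue N K f) (hKN : K ≤ N) (l l' r : List ℝ)
    (hl : l.Perm l') (hlK : l.length ≤ K) (hN : l.length + r.length = N) :
    bellmanStep K β p p01 p11 f (l ++ r) = bellmanStep K β p p01 p11 f (l' ++ r) := by
  obtain ⟨r₁, r₂, rfl, hr⟩ : ∃ r₁ r₂, r = r₁ ++ r₂ ∧ l.length + r₁.length = K :=
    ⟨r.take (K - l.length), r.drop (K - l.length), by simp, by simp; omega⟩
  have hl' := hl.length_eq
  rw [← List.append_assoc, ← List.append_assoc, bellmanStep_append _ _ (by simpa using hr),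
    bellmanStep_append _ _ (by simpa [← hl'] using hr),
    activationMean_perm hf (l ++ r₁) (l' ++ r₁) (hl.append_right _) _ _ _ _
      (by simp; omega) (by simp at hN ⊢; omega), (hl.append_right r₁).sum_eq]

lemma bellmanStep_affine (hf : IsRegularValue N K f) (l r : List ℝ) (a b t : ℝ) :
    bellmanStep K β p p01 p11 f (l ++ (t * a + (1 - t) * b) :: r) =
      t * bellmanStep K β p p01 p11 f (l ++ a :: r) +
        (1 - t) * bellmanStep K β p p01 p11 f (l ++ b :: r) := by
  rcases lt_or_ge l.length K with h | h
  · obtain ⟨k, rfl⟩ : ∃ k, K = l.length + (k + 1) := ⟨K - l.length - 1, by omega⟩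
    simp only [bellmanStep, List.take_length_add_append, List.drop_length_add_append,
      List.take_succ_cons, List.drop_succ_cons, activationMean_affine_scheduled hf,
      List.sum_append, List.sum_cons]
    ring
  · obtain ⟨l₁, l₂, rfl, hl⟩ : ∃ l₁ l₂, l = l₁ ++ l₂ ∧ l₁.length = K :=
      ⟨l.take K, l.drop K, by simp, by simpa using h⟩
    simp only [List.append_assoc, bellmanStep_append _ _ hl, activationMean_affine_rest hf]
    ring

/-- Replacing an unscheduled entry `p11` by a harvesting active coordinate, at the price of turning
an entry `p01` at the end of the list into an earlier one, loses at most `1`. -/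
lemma IsRegularValue.harvest_le (hf : IsRegularValue N K f) (hp010 : 0 ≤ p01)
    (hp0111 : p01 ≤ p11) (hp111 : p11 ≤ 1) (h e : ℕ) (w S R : List ℝ)
    (hw : ∀ z ∈ w, z ∈ Set.Icc p01 p11) (hS : ∀ z ∈ S, z ∈ Set.Icc p01 p11)
    (hR : ∀ z ∈ R, z ∈ Set.Icc p01 p11)
    (hN : h + w.length + S.length + R.length + e + 2 = N) :
    f (List.replicate h p11 ++ (w ++ (S ++ p11 :: (R ++ List.replicate (1 + e) p01)))) ≤
      f (List.replicate (h + 1) p11 ++ (w ++ p01 :: (S ++ (R ++ List.replicate e p01)))) + 1 := by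
  have hI : ∀ z, z = p11 ∨ z = p01 ∨ z ∈ w ∨ z ∈ S ∨ z ∈ R → z ∈ Set.Icc p01 p11 := by
    rintro z (rfl | rfl | hz | hz | hz)
    · exact ⟨hp0111, le_rfl⟩
    · exact ⟨le_rfl, hp0111⟩
    · exact hw z hz
    · exact hS z hz
    · exact hR z hz
  have h1 := hf.move_large (w ++ S) (List.replicate h p11)
    (R ++ List.replicate (1 + e) p01) p11 (by simp; omega)
    (fun z hz => by
      have := hI z (by simp [List.mem_replicate] at hz; tauto)
      exact ⟨hp010.trans this.1, this.2.trans hp111⟩)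
    (fun z hz => (hI z (by simp at hz; tauto)).2)
  have h2 := hf.move_last (List.replicate h p11 ++ p11 :: w)
    (S ++ (R ++ List.replicate e p01)) p01 (by simp; omega) hp010
    (fun z hz => by
      have := hI z (by simp [List.mem_replicate] at hz; tauto)
      exact ⟨this.1, this.2.trans hp111⟩)
  have e1 : ∀ l : List ℝ, List.replicate (h + 1) p11 ++ l = List.replicate h p11 ++ p11 :: l := by
    intro l; simp [List.replicate_succ']
  have e2 : List.replicate (1 + e) p01 = List.replicate e p01 ++ [p01] := by
    rw [add_comm, List.replicate_succ']
  rw [e1]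
  simp only [e2, List.append_assoc, List.cons_append] at h1 h2 ⊢
  linarith

lemma affine_map_mem (hp0111 : p01 ≤ p11) (R : List ℝ) (hR : ∀ z ∈ R, z ∈ Set.Icc (0 : ℝ) 1) :
    ∀ z ∈ R.map (fun x => (p11 - p01) * x + p01), z ∈ Set.Icc p01 p11 := by
  intro z hz
  obtain ⟨x, hx, rfl⟩ := List.mem_map.1 hz
  have := hR x hx
  constructor <;> nlinarith [this.1, this.2]

lemma bellmanStep_swap (hf : IsRegularValue N K f) (hKN : K ≤ N)
    (hβ : β ∈ Set.Icc (0 : ℝ) 1) (hp : p ∈ Set.Icc (0 : ℝ) 1) (hp010 : 0 ≤ p01)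
    (hp0111 : p01 ≤ p11) (hp111 : p11 ≤ 1) (X R : List ℝ) (x y : ℝ)
    (hN : X.length + R.length + 2 = N)
    (hb : ∀ z ∈ X ++ x :: y :: R, z ∈ Set.Icc (0 : ℝ) 1) (hxy : y ≤ x) :
    bellmanStep K β p p01 p11 f (X ++ y :: x :: R) ≤
      bellmanStep K β p p01 p11 f (X ++ x :: y :: R) := by
  have hIw : ∀ w : List ℝ, (∀ z ∈ w, z ∈ Set.Icc p01 p11) →
      ∀ z ∈ w, z ∈ Set.Icc (0 : ℝ) 1 := fun w hw z hz =>
    ⟨hp010.trans (hw z hz).1, (hw z hz).2.trans hp111⟩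
  have hp01I : p01 ∈ Set.Icc (0 : ℝ) 1 := ⟨hp010, hp0111.trans hp111⟩
  have hp11I : p11 ∈ Set.Icc (0 : ℝ) 1 := ⟨hp010.trans hp0111, hp111⟩
  have hXb : ∀ z ∈ X, z ∈ Set.Icc (0 : ℝ) 1 := fun z hz => hb z (by simp [hz])
  have hRb : ∀ z ∈ R, z ∈ Set.Icc (0 : ℝ) 1 := fun z hz => hb z (by simp [hz])
  have hRm := affine_map_mem hp0111 R hRb
  rcases lt_trichotomy (X.length + 1) K with hX | hX | hX
  · apply le_of_eq
    have := bellmanStep_perm (β := β) (p := p) (p01 := p01) (p11 := p11) hf hKN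
      (X ++ [y, x]) (X ++ [x, y]) R
      (List.Perm.append_left X (List.Perm.swap _ _ [])) (by simp; omega) (by simp; omega)
    simpa using this
  · have h0 := IsRegularValue.exchange_eq
      (bellmanStep_affine (K := K) (β := β) (p := p) (p01 := p01) (p11 := p11) hf) X [] R x y
    have key : bellmanStep K β p p01 p11 f (X ++ 0 :: 1 :: R) ≤
        bellmanStep K β p p01 p11 f (X ++ 1 :: 0 :: R) := by
      have e : ∀ a b : ℝ, bellmanStep K β p p01 p11 f (X ++ a :: b :: R) =
          p * (X.sum + a) + β * activationMean p p01 p11 f (a :: X) 0 [] 0 (b :: R) := by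
        intro a b
        rw [← activationMean_perm hf (X ++ [a]) (a :: X) (List.perm_append_singleton a X) _ _ _ _
          (by simp; omega) (by simp; omega)]
        have := bellmanStep_append (β := β) (p := p) (p01 := p01) (p11 := p11) (f := f)
          (X ++ [a]) (b :: R) (by simpa using hX)
        simpa using this
      have h1 : activationMean p p01 p11 f X 0 [p01] 0 (1 :: R) ≤
          activationMean p p01 p11 f X 0 [p11] 0 (0 :: R) + 0 := by
        apply activationMean_le_add hp hp0111 0 X hXb
        intro k e w hw hwb
        have := hf.exchange (List.replicate k p11) w
          (R.map (fun x => (p11 - p01) * x + p01) ++ List.replicate e p01) p11 p01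
          (by simp; omega) (by
            intro z hz
            simp only [List.mem_append, List.mem_replicate] at hz
            rcases hz with ⟨_, rfl⟩ | hz | hz | ⟨_, rfl⟩
            · exact hp11I
            · exact hIw w hwb z hz
            · exact hIw _ hRm z hz
            · exact hp01I) hp0111
        simpa using this
      have h2 : activationMean p p01 p11 f X 0 [] 1 (1 :: R) ≤
          activationMean p p01 p11 f X 1 [] 0 (0 :: R) + 1 := by
        apply activationMean_le_add hp hp0111 1 X hXb
        intro k e w hw hwb
        have := hf.harvest_le hp010 hp0111 hp111 k e w [] _ hwb (by simp) hRm
          (by simp; omega)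
        simpa [add_comm 1 k] using this
      rw [e, e]
      simp only [activationMean, List.nil_append, mul_zero, mul_one, zero_add, sub_zero, sub_self,
        zero_mul, add_zero, sub_add_cancel] at h1 h2 ⊢
      have g1 := mul_le_mul_of_nonneg_left h1 (sub_nonneg.2 hp.2)
      have g2 := mul_le_mul_of_nonneg_left h2 hp.1
      have g3 := mul_le_mul_of_nonneg_left (add_le_add g1 g2) hβ.1
      have g4 := mul_le_mul_of_nonneg_right hβ.2 hp.1
      linarith
    simp only [List.nil_append] at h0
    have := mul_nonneg (sub_nonneg.2 hxy) (sub_nonneg.2 key)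
    linarith
  · obtain ⟨X₁, X₂, rfl, hl⟩ : ∃ l₁ l₂, X = l₁ ++ l₂ ∧ l₁.length = K :=
      ⟨X.take K, X.drop K, by simp, by simp; omega⟩
    simp only [List.append_assoc, bellmanStep_append _ _ hl]
    gcongr
    · exact hβ.1
    rw [← add_zero (activationMean p p01 p11 f X₁ 0 [] 0 (X₂ ++ x :: y :: R))]
    apply activationMean_le_add hp hp0111 0 X₁ (fun z hz => hXb z (by simp [hz]))
    intro k e w hw hwb
    have hm := affine_map_mem hp0111 (X₂ ++ x :: y :: R) (fun z hz => hb z (by simp at hz ⊢; tauto))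
    have := hf.swap (List.replicate k p11 ++ (w ++ X₂.map (fun x => (p11 - p01) * x + p01)))
      (R.map (fun x => (p11 - p01) * x + p01) ++ List.replicate e p01)
      ((p11 - p01) * x + p01) ((p11 - p01) * y + p01) (by simp at hN ⊢; omega) (by
        intro z hz
        have hz' : z ∈ List.replicate k p11 ∨ z ∈ w ∨
            z ∈ (X₂ ++ x :: y :: R).map (fun x => (p11 - p01) * x + p01) ∨
            z ∈ List.replicate e p01 := by
          simp only [List.mem_append, List.mem_cons, List.map_append, List.map_cons] at hz ⊢
          tauto
        simp only [List.mem_replicate] at hz'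
        rcases hz' with ⟨_, rfl⟩ | hz | hz | ⟨_, rfl⟩
        · exact hp11I
        · exact hIw w hwb z hz
        · exact hIw _ hm z hz
        · exact hp01I)
      (by nlinarith)
    simpa using this

lemma bellmanStep_rotate (hf : IsRegularValue N K f) (hK : 1 ≤ K) (hKN : K ≤ N)
    (hβ : β ∈ Set.Icc (0 : ℝ) 1) (hp : p ∈ Set.Icc (0 : ℝ) 1) (hp010 : 0 ≤ p01)
    (hp0111 : p01 ≤ p11) (hp111 : p11 ≤ 1) (L : List ℝ) (y : ℝ) (hN : L.length + 1 = N)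
    (hb : ∀ z ∈ y :: L, z ∈ Set.Icc (0 : ℝ) 1) :
    bellmanStep K β p p01 p11 f (L ++ [y]) ≤ bellmanStep K β p p01 p11 f (y :: L) + 1 := by
  rcases hKN.eq_or_lt with hKN' | hKN'
  · have := bellmanStep_perm (β := β) (p := p) (p01 := p01) (p11 := p11) hf hKN
      (L ++ [y]) (y :: L) [] (List.perm_append_singleton y L) (by simp; omega) (by simpa using hN)
    simp only [List.append_nil] at this
    linarith
  obtain ⟨M, r, S, rfl, hM⟩ : ∃ M r S, L = M ++ r :: S ∧ M.length + 1 = K := by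
    refine ⟨L.take (K - 1), L[K - 1]'(by omega), L.drop K, ?_, by simp; omega⟩
    conv_lhs => rw [← List.take_append_drop (K - 1) L, List.drop_eq_getElem_cons (by omega)]
    rw [Nat.sub_add_cancel hK]
  have hMb : ∀ z ∈ M, z ∈ Set.Icc (0 : ℝ) 1 := fun z hz => hb z (by simp [hz])
  have hSm := affine_map_mem hp0111 S (fun z hz => hb z (by simp [hz]))
  have hy := hb y (by simp)
  have hr := hb r (by simp)
  have e1 : ∀ a b : ℝ, bellmanStep K β p p01 p11 f (a :: (M ++ b :: S)) =
      p * (a + M.sum) + β * activationMean p p01 p11 f (a :: M) 0 [] 0 (b :: S) := by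
    intro a b
    have := bellmanStep_append (β := β) (p := p) (p01 := p01) (p11 := p11) (f := f)
      (a :: M) (b :: S) (by simpa using hM)
    simpa using this
  have e2 : ∀ a b : ℝ, bellmanStep K β p p01 p11 f (M ++ b :: (S ++ [a])) =
      p * (b + M.sum) + β * activationMean p p01 p11 f (b :: M) 0 [] 0 (S ++ [a]) := by
    intro a b
    rw [← activationMean_perm hf (M ++ [b]) (b :: M) (List.perm_append_singleton b M) _ _ _ _
      (by simp; omega) (by simp at hN ⊢; omega)]
    have := bellmanStep_append (β := β) (p := p) (p01 := p01) (p11 := p11) (f := f)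
      (M ++ [b]) (S ++ [a]) (by simpa using hM)
    simpa [add_comm] using this
  have hSN : M.length + S.length + 2 = N := by simp at hN; omega
  have hI01 : p01 ∈ Set.Icc p01 p11 := ⟨le_rfl, hp0111⟩
  have hI11 : p11 ∈ Set.Icc p01 p11 := ⟨hp0111, le_rfl⟩
  set S' := S.map (fun x => (p11 - p01) * x + p01) with hS'
  have hSl : S'.length = S.length := by simp [hS']
  have hI : ∀ (w : List ℝ), (∀ z ∈ w, z ∈ Set.Icc p01 p11) →
      ∀ z, z = p11 ∨ z = p01 ∨ z ∈ w ∨ z ∈ S' → z ∈ Set.Icc p01 p11 := by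
    rintro w hw z (rfl | rfl | hz | hz)
    exacts [hI11, hI01, hw z hz, hSm z hz]
  have hU : ∀ z, z ∈ Set.Icc p01 p11 → z ∈ Set.Icc (0 : ℝ) 1 :=
    fun z hz => ⟨hp010.trans hz.1, hz.2.trans hp111⟩
  have rep : ∀ (e : ℕ) (a : ℝ), a :: List.replicate e a = List.replicate e a ++ [a] := by
    intro e a
    rw [← List.replicate_succ, List.replicate_succ']
  have shift : ∀ (Y w : List ℝ) (e : ℕ), (∀ z ∈ w, z ∈ Set.Icc p01 p11) →
      (∀ z ∈ Y, z = p11 ∨ z = p01 ∨ z ∈ w) → Y.length + S'.length + e + 1 = N →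
      f (Y ++ (S' ++ p01 :: List.replicate e p01)) ≤
        f (Y ++ p01 :: (S' ++ List.replicate e p01)) + 1 := by
    intro Y w e hw hY hl
    have := hf.move_last Y (S' ++ List.replicate e p01) p01 (by simp at hl ⊢; omega) hp010
      (fun z hz => by
        have hz' := hI w hw z (by
          simp only [List.mem_cons, List.mem_append, List.mem_replicate] at hz
          have := hY z
          tauto)
        exact ⟨hz'.1, hz'.2.trans hp111⟩)
    rw [rep]
    simpa using this
  have large : ∀ (Y w : List ℝ) (e : ℕ), (∀ z ∈ w, z ∈ Set.Icc p01 p11) →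
      (∀ z ∈ Y, z = p11 ∨ z = p01 ∨ z ∈ w) → Y.length + S'.length + e + 1 = N →
      f (Y ++ (S' ++ p11 :: List.replicate e p01)) ≤
        f (Y ++ p11 :: (S' ++ List.replicate e p01)) := by
    intro Y w e hw hY hl
    exact hf.move_large S' Y (List.replicate e p01) p11 (by simp; omega)
      (fun z hz => hU z (hI w hw z (by
        simp only [List.mem_cons, List.mem_append, List.mem_replicate] at hz
        have := hY z
        tauto)))
      (fun z hz => (hSm z hz).2)
  have c1 : activationMean p p01 p11 f M 0 [p01] 0 (S ++ [0]) ≤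
      activationMean p p01 p11 f M 0 [p01] 0 (0 :: S) + 1 := by
    apply activationMean_le_add hp hp0111 1 M hMb
    intro k e w hw hwb
    have := shift (List.replicate k p11 ++ p01 :: w) w e hwb
      (by simp [List.mem_replicate]; tauto) (by simp; omega)
    simpa [← hS'] using this
  have c2 : activationMean p p01 p11 f M 0 [] 1 (S ++ [0]) ≤
      activationMean p p01 p11 f M 0 [] 1 (0 :: S) + 1 := by
    apply activationMean_le_add hp hp0111 1 M hMb
    intro k e w hw hwb
    have := shift (List.replicate k p11 ++ w) w (1 + e) hwb
      (by simp [List.mem_replicate]; tauto) (by simp; omega)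
    simpa [← hS'] using this
  have c3 : activationMean p p01 p11 f M 0 [p11] 0 (S ++ [1]) ≤
      activationMean p p01 p11 f M 0 [p11] 0 (1 :: S) + 0 := by
    apply activationMean_le_add hp hp0111 0 M hMb
    intro k e w hw hwb
    have := large (List.replicate k p11 ++ p11 :: w) w e hwb
      (by simp [List.mem_replicate]; tauto) (by simp; omega)
    simpa [← hS'] using this
  have c4 : activationMean p p01 p11 f M 1 [] 0 (S ++ [1]) ≤
      activationMean p p01 p11 f M 1 [] 0 (1 :: S) + 0 := by
    apply activationMean_le_add hp hp0111 0 M hMb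
    intro k e w hw hwb
    have := large (List.replicate (1 + k) p11 ++ w) w e hwb
      (by simp [List.mem_replicate]; tauto) (by simp; omega)
    simpa [← hS'] using this
  have c5 : activationMean p p01 p11 f M 0 [] 1 (S ++ [1]) ≤
      activationMean p p01 p11 f M 1 [] 0 (0 :: S) + 1 := by
    apply activationMean_le_add hp hp0111 1 M hMb
    intro k e w hw hwb
    have := hf.harvest_le hp010 hp0111 hp111 k e w S' [] hwb hSm (by simp) (by simp; omega)
    simpa [← hS', add_comm 1 k] using this
  have c6 : activationMean p p01 p11 f M 0 [p01] 0 (S ++ [1]) ≤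
      activationMean p p01 p11 f M 0 [p11] 0 (0 :: S) + 0 := by
    apply activationMean_le_add hp hp0111 0 M hMb
    intro k e w hw hwb
    have h1 := hf.move_large (p01 :: (w ++ S')) (List.replicate k p11) (List.replicate e p01) p11
      (by simp; omega)
      (fun z hz => hU z (hI w hwb z (by
        simp only [List.mem_cons, List.mem_append, List.mem_replicate] at hz
        tauto)))
      (fun z hz => (hI w hwb z (by
        simp only [List.mem_cons, List.mem_append] at hz
        tauto)).2)
    have h2 := hf.move_small w (List.replicate k p11 ++ [p11]) (S' ++ List.replicate e p01) p01
      (by simp; omega)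
      (fun z hz => hU z (hI w hwb z (by
        simp only [List.mem_cons, List.mem_append, List.mem_replicate, List.not_mem_nil] at hz
        tauto)))
      (fun z hz => (hwb z hz).1)
    simp only [List.append_assoc, List.cons_append, List.nil_append] at h1 h2
    simpa [← hS'] using h1.trans h2
  have c7 : activationMean p p01 p11 f M 1 [] 0 (S ++ [0]) ≤
      activationMean p p01 p11 f M 0 [] 1 (1 :: S) + 0 := by
    apply activationMean_le_add hp hp0111 0 M hMb
    intro k e w hw hwb
    have := hf.perm (List.replicate k p11 ++ p11 :: w) (List.replicate k p11 ++ (w ++ [p11]))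
      (S' ++ p01 :: List.replicate e p01)
      ((List.perm_append_singleton p11 w).symm.append_left _) (by simp; omega) (by simp; omega)
    rw [show 1 + e = e + 1 by omega, show 1 + k = k + 1 by omega, List.replicate_succ' (n := k)]
    simp only [List.append_assoc, List.cons_append, List.nil_append] at this
    simpa [← hS', List.replicate_succ] using this.le
  have c8 : activationMean p p01 p11 f M 0 [p11] 0 (S ++ [0]) ≤
      activationMean p p01 p11 f M 0 [p01] 0 (1 :: S) + 1 := by
    apply activationMean_le_add hp hp0111 1 M hMb
    intro k e w hw hwb
    have h1 := hf.perm (List.replicate k p11 ++ p11 :: w) (List.replicate k p11 ++ (w ++ [p11]))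
      (S' ++ p01 :: List.replicate e p01)
      ((List.perm_append_singleton p11 w).symm.append_left _) (by simp; omega) (by simp; omega)
    have h2 := hf.move_last (List.replicate k p11 ++ w) (p11 :: (S' ++ List.replicate e p01)) p01
      (by simp; omega) hp010
      (fun z hz => by
        have hz' := hI w hwb z (by
          simp only [List.mem_cons, List.mem_append, List.mem_replicate] at hz
          tauto)
        exact ⟨hz'.1, hz'.2.trans hp111⟩)
    have h3 := hf.perm (List.replicate k p11 ++ (w ++ [p01])) (List.replicate k p11 ++ p01 :: w)
      (p11 :: (S' ++ List.replicate e p01))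
      ((List.perm_append_singleton p01 w).append_left _) (by simp; omega) (by simp; omega)
    rw [rep] at h1
    simp only [List.append_assoc, List.cons_append, List.nil_append] at h1 h2 h3
    have h4 := (h1.le.trans h2).trans (add_le_add_left h3.le 1)
    rw [← rep] at h4
    simpa [← hS'] using h4
  have hβp := mul_le_mul_of_nonneg_right hβ.2 hp.1
  have hβq := mul_le_mul_of_nonneg_right hβ.2 (sub_nonneg.2 hp.2)
  have combine : ∀ {a b c d s t : ℝ}, a ≤ b + s → c ≤ d + t →
      β * ((1 - p) * a + p * c) ≤ β * ((1 - p) * b + p * d) + β * ((1 - p) * s + p * t) := by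
    intro a b c d s t h1 h2
    have g1 := mul_le_mul_of_nonneg_left h1 (sub_nonneg.2 hp.2)
    have g2 := mul_le_mul_of_nonneg_left h2 hp.1
    have g3 := mul_le_mul_of_nonneg_left (add_le_add g1 g2) hβ.1
    linarith
  have k00 : bellmanStep K β p p01 p11 f (M ++ 0 :: (S ++ [0])) ≤
      bellmanStep K β p p01 p11 f (0 :: (M ++ 0 :: S)) + 1 := by
    rw [e1, e2]
    simp only [activationMean, List.nil_append, mul_zero, zero_add, sub_zero, zero_mul, one_mul]
    linarith [combine c1 c2, hβ.2]
  have k11 : bellmanStep K β p p01 p11 f (M ++ 1 :: (S ++ [1])) ≤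
      bellmanStep K β p p01 p11 f (1 :: (M ++ 1 :: S)) + 1 := by
    rw [e1, e2]
    simp only [activationMean, List.nil_append, mul_one, zero_add, sub_self, zero_mul, one_mul,
      sub_add_cancel, add_zero]
    linarith [combine c3 c4]
  have k10 : bellmanStep K β p p01 p11 f (M ++ 0 :: (S ++ [1])) ≤
      bellmanStep K β p p01 p11 f (1 :: (M ++ 0 :: S)) + 1 := by
    rw [e1, e2]
    simp only [activationMean, List.nil_append, mul_one, zero_add, sub_self, zero_mul, one_mul,
      sub_add_cancel, add_zero, mul_zero, sub_zero]
    linarith [combine c6 c5]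
  have k01 : bellmanStep K β p p01 p11 f (M ++ 1 :: (S ++ [0])) ≤
      bellmanStep K β p p01 p11 f (0 :: (M ++ 1 :: S)) + 1 := by
    rw [e1, e2]
    simp only [activationMean, List.nil_append, mul_one, zero_add, sub_self, zero_mul, one_mul,
      sub_add_cancel, add_zero, mul_zero, sub_zero]
    linarith [combine c8 c7]
  have b1 := IsRegularValue.biaffine_eq
    (bellmanStep_affine (K := K) (β := β) (p := p) (p01 := p01) (p11 := p11) hf) [] M S y r
  have b2 := IsRegularValue.biaffine_eq
    (bellmanStep_affine (K := K) (β := β) (p := p) (p01 := p01) (p11 := p11) hf) M S [] r y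
  simp only [List.nil_append] at b1 b2
  simp only [List.append_assoc, List.cons_append]
  rw [b1, b2]
  have y1 := sub_nonneg.2 hy.2
  have r1 := sub_nonneg.2 hr.2
  have g00 := mul_le_mul_of_nonneg_left k00 (mul_nonneg y1 r1)
  have g01 := mul_le_mul_of_nonneg_left k01 (mul_nonneg y1 hr.1)
  have g10 := mul_le_mul_of_nonneg_left k10 (mul_nonneg hy.1 r1)
  have g11 := mul_le_mul_of_nonneg_left k11 (mul_nonneg hy.1 hr.1)
  linarith

lemma IsRegularValue.bellmanStep (hf : IsRegularValue N K f) (hK : 1 ≤ K) (hKN : K ≤ N)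
    (hβ : β ∈ Set.Icc (0 : ℝ) 1) (hp : p ∈ Set.Icc (0 : ℝ) 1) (hp010 : 0 ≤ p01)
    (hp0111 : p01 ≤ p11) (hp111 : p11 ≤ 1) :
    IsRegularValue N K (bellmanStep K β p p01 p11 f) where
  perm := bellmanStep_perm hf hKN
  affine := bellmanStep_affine hf
  swap := bellmanStep_swap hf hKN hβ hp hp010 hp0111 hp111
  rotate := bellmanStep_rotate hf hK hKN hβ hp hp010 hp0111 hp111

/-- The value functions on lists, indexed by the number of remaining slots. -/
noncomputable def listValue (K : ℕ) (β p p01 p11 : ℝ) : ℕ → List ℝ → ℝ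
  | 0, l => p * (l.take K).sum
  | m + 1, l => bellmanStep K β p p01 p11 (listValue K β p p01 p11 m) l

lemma isRegularValue_zero : IsRegularValue N K (fun _ => 0) :=
  ⟨by simp, by simp, by simp, by simp⟩

lemma isRegularValue_listValue (hK : 1 ≤ K) (hKN : K ≤ N)
    (hβ : β ∈ Set.Icc (0 : ℝ) 1) (hp : p ∈ Set.Icc (0 : ℝ) 1) (hp010 : 0 ≤ p01)
    (hp0111 : p01 ≤ p11) (hp111 : p11 ≤ 1) (m : ℕ) :
    IsRegularValue N K (listValue K β p p01 p11 m) := by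
  induction m with
  | zero =>
    have := (isRegularValue_zero (N := N) (K := K)).bellmanStep hK hKN (β := 0) (by simp) hp
      hp010 hp0111 hp111
    convert this using 1
    ext l
    simp [listValue, _root_.bellmanStep]
  | succ m ih => exact ih.bellmanStep hK hKN hβ hp hp010 hp0111 hp111

end ListModel

lemma activationMean_map_eq_sum {ι : Type*} [DecidableEq ι] (p p01 p11 : ℝ)
    (f : List ℝ → ℝ) (v : ι → ℝ) (l : List ι) (hl : l.Nodup) (h : ℕ) (u : List ℝ) (c : ℕ)
    (r : List ℝ) :
    activationMean p p01 p11 f (l.map v) h u c r =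
      ∑ E ∈ l.toFinset.powerset, ∑ H ∈ E.powerset,
        ((1 - p) ^ (l.length - E.card) * p ^ E.card * (∏ j ∈ H, v j) *
          (∏ j ∈ E \ H, (1 - v j))) *
        f (List.replicate (h + H.card) p11 ++ (u ++
          ((l.filter (· ∉ E)).map (fun j => (p11 - p01) * v j + p01) ++
          (r.map (fun x => (p11 - p01) * x + p01) ++
            List.replicate (c + (E.card - H.card)) p01)))) := by
  induction l generalizing h u c with
  | nil => simp [activationMean]
  | cons a l ih =>
    obtain ⟨ha, hl⟩ := List.nodup_cons.1 hl
    have ha' : a ∉ l.toFinset := by simpa using ha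
    rw [List.toFinset_cons, Finset.sum_powerset_insert ha', List.map_cons]
    simp only [activationMean]
    rw [ih hl, ih hl, ih hl]
    congr 1
    · rw [Finset.mul_sum]
      refine Finset.sum_congr rfl fun E hE => ?_
      rw [Finset.mul_sum]
      refine Finset.sum_congr rfl fun H _ => ?_
      rw [Finset.mem_powerset] at hE
      have haE : a ∉ E := fun h => ha' (hE h)
      have hcard : E.card ≤ l.length := (Finset.card_le_card hE).trans l.toFinset_card_le
      rw [List.length_cons, Nat.sub_add_comm hcard, pow_succ]
      simp only [List.append_assoc, List.cons_append, List.nil_append, haE, not_false_eq_true,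
        decide_true, List.filter_cons_of_pos, List.map_cons]
      ring
    · rw [Finset.mul_sum, Finset.mul_sum, ← Finset.sum_add_distrib, Finset.mul_sum]
      refine Finset.sum_congr rfl fun E hE => ?_
      rw [Finset.mem_powerset] at hE
      have haE : a ∉ E := fun h => ha' (hE h)
      have hfil : (a :: l).filter (· ∉ insert a E) = l.filter (· ∉ E) := by
        rw [List.filter_cons_of_neg (by simp)]
        refine List.filter_congr fun x hx => ?_
        have : x ≠ a := fun h => ha (h ▸ hx)
        simp [this]
      rw [Finset.sum_powerset_insert haE, hfil, Finset.card_insert_of_notMem haE, add_comm,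
        mul_add, Finset.mul_sum, Finset.mul_sum, Finset.mul_sum, Finset.mul_sum,
        List.length_cons, Nat.add_sub_add_right]
      congr 1
      · refine Finset.sum_congr rfl fun H hH => ?_
        rw [Finset.mem_powerset] at hH
        have haH : a ∉ H := fun h => haE (hH h)
        have hle := Finset.card_le_card hH
        rw [Finset.insert_sdiff_of_notMem _ haH,
          Finset.prod_insert (fun h => haE (Finset.mem_sdiff.1 h).1), Nat.sub_add_comm hle,
          show c + (E.card - H.card + 1) = c + 1 + (E.card - H.card) by omega, pow_succ]
        ring
      · refine Finset.sum_congr rfl fun H hH => ?_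
        rw [Finset.mem_powerset] at hH
        have haH : a ∉ H := fun h => haE (hH h)
        rw [Finset.card_insert_of_notMem haH, Nat.add_sub_add_right,
          Finset.prod_insert haH, Finset.insert_sdiff_insert,
          Finset.sdiff_insert_of_notMem haE, show h + (H.card + 1) = h + 1 + H.card by omega,
          pow_succ]
        ring

lemma sched_eq_toFinset (N K : ℕ) : sched N K = ((List.finRange N).take K).toFinset := by
  ext i
  simp only [sched, Finset.mem_filter, Finset.mem_univ, true_and, List.mem_toFinset,
    List.mem_take_iff_getElem]
  constructor
  · intro h
    exact ⟨i, by simp [h], by simp⟩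
  · rintro ⟨k, hk, rfl⟩
    simp at hk ⊢
    omega

lemma sort_univ_sdiff {N : ℕ} (E : Finset (Fin N)) :
    (Finset.univ \ E).sort (· ≤ ·) = (List.finRange N).filter (· ∉ E) := by
  refine List.Perm.eq_of_pairwise (le := (· ≤ ·)) (fun a b _ _ => le_antisymm)
    (Finset.pairwise_sort _ _) ((List.pairwise_le_finRange N).filter _) ?_
  refine (List.perm_ext_iff_of_nodup (Finset.sort_nodup _ _)
    ((List.nodup_finRange N).filter _)).2 fun a => ?_
  simp

lemma ofFn_getD_eq (l : List ℝ) (N : ℕ) (hl : l.length = N) :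
    List.ofFn (fun i : Fin N => l.getD i.val 0) = l := by
  subst hl
  apply List.ext_getElem <;> simp

lemma ofFn_nextVec2 (N K : ℕ) (p01 p11 : ℝ) (E H : Finset (Fin N)) (hE : E ⊆ sched N K)
    (hH : H ⊆ E) (v : Fin N → ℝ) :
    List.ofFn (nextVec2 N p01 p11 E H v) =
      List.replicate H.card p11 ++
        ((((List.finRange N).take K).filter (· ∉ E)).map (fun j => (p11 - p01) * v j + p01) ++
        (((List.ofFn v).drop K).map (fun x => (p11 - p01) * x + p01) ++
          List.replicate (E.card - H.card) p01)) := by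
  unfold nextVec2
  rw [ofFn_getD_eq]
  · have hdrop : ((List.finRange N).drop K).filter (· ∉ E) = (List.finRange N).drop K := by
      rw [List.filter_eq_self]
      intro a ha
      have hnd := List.nodup_finRange N
      rw [← List.take_append_drop K (List.finRange N), List.nodup_append] at hnd
      have hd := hnd.2.2
      simp only [decide_eq_true_eq]
      intro haE
      have h1 := hE haE
      rw [sched_eq_toFinset, List.mem_toFinset] at h1
      exact hd a h1 a ha rfl
    rw [sort_univ_sdiff]
    conv_lhs => rw [← List.take_append_drop K (List.finRange N)]
    rw [List.filter_append, hdrop, List.ofFn_eq_map, List.map_append, ← List.map_drop]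
    simp [Function.comp_def]
  · have h1 := Finset.card_le_card hH
    have h2 := Finset.card_le_univ E
    simp [Finset.card_univ_sdiff] at h2 ⊢
    omega

lemma W2_eq_listValue (N K : ℕ) (hKN : K ≤ N) (β p p01 p11 : ℝ) (m : ℕ) (v : Fin N → ℝ) :
    W2 N K β p p01 p11 m v = listValue K β p p01 p11 m (List.ofFn v) := by
  have hsum : ∀ v : Fin N → ℝ, ∑ i ∈ sched N K, v i = ((List.ofFn v).take K).sum := by
    intro v
    rw [sched_eq_toFinset, List.sum_toFinset _ ((List.nodup_finRange N).sublist
      (List.take_sublist _ _)), List.ofFn_eq_map, List.map_take]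
  induction m generalizing v with
  | zero => simp [W2, listValue, hsum]
  | succ m ih =>
    simp only [W2, listValue, bellmanStep]
    rw [hsum]
    conv_rhs => enter [2, 2]; rw [List.ofFn_eq_map, ← List.map_take]
    rw [activationMean_map_eq_sum _ _ _ _ _ _ ((List.nodup_finRange N).sublist
      (List.take_sublist _ _)), ← sched_eq_toFinset]
    congr 2
    refine Finset.sum_congr rfl fun E hE => Finset.sum_congr rfl fun H hH => ?_
    rw [ih, ofFn_nextVec2 N K p01 p11 E H (Finset.mem_powerset.1 hE) (Finset.mem_powerset.1 hH)]
    simp [hKN, List.ofFn_eq_map]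

lemma ofFn_swap {N : ℕ} (v : Fin N → ℝ) (i j : Fin N) (hji : j < i) :
    ∃ X M R : List ℝ, List.ofFn v = X ++ v j :: (M ++ v i :: R) ∧
      List.ofFn (v ∘ Equiv.swap i j) = X ++ v i :: (M ++ v j :: R) := by
  obtain ⟨X, t, hX⟩ := List.append_of_mem (List.mem_finRange j)
  have hlt := List.pairwise_lt_finRange N
  have hnd := List.nodup_finRange N
  have hi := List.mem_finRange i
  rw [hX] at hlt hnd hi
  have hit : i ∈ t := by
    rcases List.mem_append.1 hi with h | h
    · exact absurd ((List.pairwise_append.1 hlt).2.2 i h j (by simp)) hji.le.not_gt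
    · exact (List.mem_cons.1 h).resolve_left hji.ne'
  obtain ⟨M, R, rfl⟩ := List.append_of_mem hit
  refine ⟨X.map v, M.map v, R.map v, by simp [List.ofFn_eq_map, hX], ?_⟩
  have hne : ∀ l : List (Fin N), i ∉ l → j ∉ l → l.map (v ∘ Equiv.swap i j) = l.map v := by
    intro l hil hjl
    refine List.map_congr_left fun a ha => ?_
    rw [Function.comp_apply, Equiv.swap_apply_of_ne_of_ne (ne_of_mem_of_not_mem ha hil)
      (ne_of_mem_of_not_mem ha hjl)]
  simp only [List.nodup_append, List.nodup_cons, List.mem_append, List.mem_cons] at hnd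
  rw [List.ofFn_eq_map, hX, List.map_append, List.map_cons, List.map_append, List.map_cons,
    hne X (by grind) (by grind), hne M (by grind) (by grind), hne R (by grind) (by grind)]
  simp

/-- Lemma 4, inequality (13b): for the batteryless pseudo value function, swapping a
coordinate `j` with a later coordinate `i ≥ j` of smaller or equal value does not increase
the pseudo value: if `j ≤ i` and `v_j ≥ v_i` then `W_n(v) ≥ W_n(v ∘ (i j))`. -/
theorem batteryless_swap_inequality
    (N K T : ℕ) (hK : 1 ≤ K) (hKN : K ≤ N) (hT : 1 ≤ T)
    (β p p01 p11 : ℝ) (hβ0 : 0 < β) (hβ1 : β ≤ 1) (hp0 : 0 ≤ p) (hp1 : p ≤ 1)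
    (hp010 : 0 ≤ p01) (hp0111 : p01 ≤ p11) (hp111 : p11 ≤ 1)
    (n : ℕ) (hn1 : 1 ≤ n) (hnT : n ≤ T)
    (v : Fin N → ℝ) (hv : ∀ i, v i ∈ Set.Icc (0 : ℝ) 1)
    (i j : Fin N) (hji : j ≤ i) (hvji : v i ≤ v j) :
    W2 N K β p p01 p11 (T - n) (v ∘ Equiv.swap i j) ≤ W2 N K β p p01 p11 (T - n) v := by
  rcases hji.eq_or_lt with rfl | hlt
  · simp
  have hreg := isRegularValue_listValue (N := N) hK hKN ⟨hβ0.le, hβ1⟩ ⟨hp0, hp1⟩ hp010 hp0111 hp111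
    (T - n)
  obtain ⟨X, M, R, hX, hX'⟩ := ofFn_swap v i j hlt
  rw [W2_eq_listValue N K hKN, W2_eq_listValue N K hKN, hX, hX']
  have hlen := congrArg List.length hX
  refine hreg.exchange X M R _ _ (by simp at hlen; omega) (fun z hz => ?_) hvji
  have hz' : z ∈ List.ofFn v := by
    rw [hX]
    simp at hz ⊢
    tauto
  obtain ⟨k, rfl⟩ := (List.mem_ofFn' _ _).1 hz'
  exact hv k
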